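/- The raising and lowering operators are mutually inverse: for any admissible triangle T on which R_d is defined, L_d(R_d(T)) = T, and for any admissible triangle T on which L_d is defined, R_d(L_d(T)) = T. -/

import Mathlib

open Finset
open scoped Classical

/-- Symbols occurring in a triangle: `x i`, `y i` (indices `1,...,n` encoded by `Fin n`),
`a i j`, `b i j` (the edge `{i+1,j+1}` oriented from smaller to larger, resp. larger to
smaller), and the numbers `1,...,n` of the bottom row. -/
inductive TSym (n : ℕ) where
  | x (i : Fin n)
  | y (i : Fin n)
  | a (i j : Fin n)
  | b (i j : Fin n)
  | num (i : Fin n)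
deriving DecidableEq

/-- A triangle of order `n`: row `r` (0-indexed) has `r+1` entries. -/
def Tri (n : ℕ) := ∀ r : Fin n, Fin (r.val + 1) → TSym n

namespace TSym

variable {n : ℕ}

/-- The symbol lies in `𝒳`. -/
def isX : TSym n → Prop
  | .x _ => True
  | .y _ => True
  | _ => False

/-- The symbol lies in `𝒱_k`. -/
def isV (k : ℕ) : TSym n → Prop
  | .a i j => j.val = i.val + k ∧ 0 < k
  | .b i j => j.val = i.val + k ∧ 0 < k
  | _ => False

/-- Well-formedness of a non-bottom entry: `a i j` and `b i j` require `i < j`;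
numbers may not occur. -/
def wf : TSym n → Prop
  | .a i j => i < j
  | .b i j => i < j
  | .num _ => False
  | _ => True

/-- The left value of a symbol lying in a row of rank `t` (values are `1`-based). -/
def lval (t : ℕ) : TSym n → ℤ
  | .x i => (i.val : ℤ) + 1
  | .y j => (j.val : ℤ) + 1 - t
  | .a i _ => (i.val : ℤ) + 1
  | .b i _ => (i.val : ℤ) + 1
  | .num i => (i.val : ℤ) + 1

/-- The right value of a symbol lying in a row of rank `t`. -/
def rval (t : ℕ) : TSym n → ℤ
  | .x i => (i.val : ℤ) + 1 + t
  | .y j => (j.val : ℤ) + 1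
  | .a _ j => (j.val : ℤ) + 1
  | .b _ j => (j.val : ℤ) + 1
  | .num i => (i.val : ℤ) + 1

end TSym

variable {n : ℕ}

/-- Row `r` is an `𝒳`-row. -/
def IsXRow (t : Tri n) (r : Fin n) : Prop := ∀ i, (t r i).isX

/-- Row `r` has all entries in `𝒱_k`. -/
def IsVRowOf (t : Tri n) (r : Fin n) (k : ℕ) : Prop := ∀ i, (t r i).isV k

/-- Row `r` is a `𝒱`-row. -/
def IsVRow (t : Tri n) (r : Fin n) : Prop := ∃ k, IsVRowOf t r k

/-- The bottom row is `(1,2,...,n)`. -/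
def BottomOK (t : Tri n) : Prop :=
  ∀ (r : Fin n), r.val = n - 1 → ∀ i : Fin (r.val + 1),
    t r i = .num ⟨i.val, by have := i.isLt; have := r.isLt; omega⟩

/-- All non-bottom entries are well-formed. -/
def WellFormed (t : Tri n) : Prop :=
  ∀ r : Fin n, r.val < n - 1 → ∀ i, (t r i).wf

/-- `rk m` is the rank of (1-based) row `m`, for `0 ≤ m ≤ n`; Lean row index `r`
corresponds to row `r+1`.  An admissible ranking: the bottom row has rank `0`,
row `n-1` has rank `1`, and going up, an `𝒳`-row keeps the rank while a row whose
entries lie in `𝒱_k` has rank `k` and raises the rank above it to `k+1`. -/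
def IsRanking (t : Tri n) (rk : ℕ → ℕ) : Prop :=
  rk n = 0 ∧ (1 ≤ n → rk (n - 1) = 1) ∧
  ∀ r : Fin n, r.val < n - 1 →
    (IsXRow t r ∧ rk r.val = rk (r.val + 1)) ∨
    (IsVRowOf t r (rk (r.val + 1)) ∧ rk r.val = rk (r.val + 1) + 1)

/-- The monotone diagonal and monotone row properties: for every local arrangement
`v` directly above consecutive entries `u, w`, we require `l(u) ≤ l(v)` (strict when
`u` is a `y`), `r(v) ≤ r(w)` (strict when `w` is an `x`), and `l(u) < l(w)`. -/
def MonoProps (t : Tri n) (rk : ℕ → ℕ) : Prop :=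
  ∀ (r : Fin n) (hr : 1 ≤ r.val) (p : ℕ) (hp : p + 1 < r.val + 1),
    let u := t r ⟨p, by omega⟩
    let w := t r ⟨p + 1, by omega⟩
    let v := t ⟨r.val - 1, by have := r.isLt; omega⟩ ⟨p, by simp only [Fin.val_mk]; omega⟩
    (u.lval (rk (r.val + 1)) ≤ v.lval (rk r.val)) ∧
    ((∃ j, u = .y j) → u.lval (rk (r.val + 1)) < v.lval (rk r.val)) ∧
    (v.rval (rk r.val) ≤ w.rval (rk (r.val + 1))) ∧
    ((∃ j, w = .x j) → v.rval (rk r.val) < w.rval (rk (r.val + 1))) ∧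
    (u.lval (rk (r.val + 1)) < w.lval (rk (r.val + 1)))

/-- Admissibility of a triangle. -/
def IsAdmissible (t : Tri n) : Prop :=
  BottomOK t ∧ WellFormed t ∧ ∃ rk, IsRanking t rk ∧ MonoProps t rk

/-- The rank of the row with Lean index `r` (i.e. of row `r+1`), computed directly:
one more than the number of `𝒱`-rows strictly below it (above the bottom row). -/
noncomputable def rankOf (t : Tri n) (r : ℕ) : ℕ :=
  1 + ((univ : Finset (Fin n)).filter fun s => r < s.val ∧ IsVRow t s).card

open MvPolynomial in
/-- The weight of a symbol. -/
noncomputable def TSym.weight : TSym n → MvPolynomial (Fin n ⊕ Fin n) ℤ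
  | .x i => X (Sum.inl i)
  | .y j => X (Sum.inr j)
  | .a i _ => X (Sum.inl i)
  | .b _ j => X (Sum.inr j)
  | .num _ => 1

/-- The weight of a triangle: the product of the weights of its non-bottom entries. -/
noncomputable def weight (t : Tri n) : MvPolynomial (Fin n ⊕ Fin n) ℤ :=
  ∏ r : Fin n, if r.val < n - 1 then ∏ i, (t r i).weight else 1

/-- The raising operator `R_d` (`1 ≤ d < n`), acting on (paper-indexed) rows `d-1`
and `d`, i.e. Lean rows `d-2` and `d-1`. -/
noncomputable def Raise (d : ℕ) (t : Tri n) : Tri n := fun r i =>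
  if hu : 2 ≤ d ∧ r.val + 2 = d ∧ r.val + 1 < n then
    -- row d-1: swap with the entry diagonally below, else convert to an 𝒳-symbol
    match t r i with
    | .b j k =>
        if t ⟨r.val + 1, hu.2.2⟩ ⟨i.val, by have := i.isLt; simp only [Fin.val_mk]; omega⟩
            = .x j then .x j else .y k
    | .a j k =>
        if t ⟨r.val + 1, hu.2.2⟩ ⟨i.val + 1, by have := i.isLt; simp only [Fin.val_mk]; omega⟩
            = .y k then .y k else .x j
    | s => s
  else if hl : r.val + 1 = d then
    -- row d: swap with the entry diagonally above, else convert to a 𝒱-symbol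
    let tk := rankOf t r.val
    match t r i with
    | .x j =>
        if hi : i.val < r.val then
          match t ⟨r.val - 1, by have := r.isLt; omega⟩
              ⟨i.val, by simp only [Fin.val_mk]; omega⟩ with
          | .b j' k => if j' = j then .b j' k
              else if h2 : j.val + tk < n then .a j ⟨j.val + tk, h2⟩ else .x j
          | _ => if h2 : j.val + tk < n then .a j ⟨j.val + tk, h2⟩ else .x j
        else if h2 : j.val + tk < n then .a j ⟨j.val + tk, h2⟩ else .x j
    | .y k =>
        if hi : 1 ≤ i.val then
          match t ⟨r.val - 1, by have := r.isLt; omega⟩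
              ⟨i.val - 1, by have := i.isLt; simp only [Fin.val_mk]; omega⟩ with
          | .a j k' => if k' = k then .a j k'
              else if h2 : tk ≤ k.val then .b ⟨k.val - tk, by have := k.isLt; omega⟩ k
              else .y k
          | _ => if h2 : tk ≤ k.val then .b ⟨k.val - tk, by have := k.isLt; omega⟩ k
              else .y k
        else if h2 : tk ≤ k.val then .b ⟨k.val - tk, by have := k.isLt; omega⟩ k else .y k
    | s => s
  else t r i

/-- The lowering operator `L_d` (`1 ≤ d < n`), inverse to `R_d`. -/
noncomputable def Lower (d : ℕ) (t : Tri n) : Tri n := fun r i =>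
  if hu : 2 ≤ d ∧ r.val + 2 = d ∧ r.val + 1 < n then
    -- row d-1: swap with the entry diagonally below, else convert to a 𝒱-symbol
    let tk := rankOf t (r.val + 1)
    match t r i with
    | .x j =>
        (match t ⟨r.val + 1, hu.2.2⟩ ⟨i.val, by have := i.isLt; simp only [Fin.val_mk]; omega⟩ with
          | .b j' k => if j' = j then .b j' k
              else if h2 : j.val + tk < n then .a j ⟨j.val + tk, h2⟩ else .x j
          | _ => if h2 : j.val + tk < n then .a j ⟨j.val + tk, h2⟩ else .x j)
    | .y k =>
        (match t ⟨r.val + 1, hu.2.2⟩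
            ⟨i.val + 1, by have := i.isLt; simp only [Fin.val_mk]; omega⟩ with
          | .a j k' => if k' = k then .a j k'
              else if h2 : tk ≤ k.val then .b ⟨k.val - tk, by have := k.isLt; omega⟩ k
              else .y k
          | _ => if h2 : tk ≤ k.val then .b ⟨k.val - tk, by have := k.isLt; omega⟩ k
              else .y k)
    | s => s
  else if hl : r.val + 1 = d then
    -- row d: swap with the entry diagonally above, else convert to an 𝒳-symbol
    match t r i with
    | .b j k =>
        if hi : i.val < r.val then
          (if t ⟨r.val - 1, by have := r.isLt; omega⟩
              ⟨i.val, by simp only [Fin.val_mk]; omega⟩ = .x j then .x j else .y k)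
        else .y k
    | .a j k =>
        if hi : 1 ≤ i.val then
          (if t ⟨r.val - 1, by have := r.isLt; omega⟩
              ⟨i.val - 1, by have := i.isLt; simp only [Fin.val_mk]; omega⟩ = .y k
           then .y k else .x j)
        else .x j
    | s => s
  else t r i

namespace TSym

/-- The effect of raising on an entry `v` of the upper row, lying above the consecutive entries
`u`, `w` of the lower row. -/
noncomputable def raiseUp (v u w : TSym n) : TSym n :=
  match v with
  | .b j k => if u = .x j then .x j else .y k
  | .a j k => if w = .y k then .y k else .x j
  | s => s

/-- The conversion of an `𝒳`-symbol to a `𝒱`-symbol of rank `k` with the same weight. -/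
def toV (k : ℕ) : TSym n → TSym n
  | .x j => if h : j.val + k < n then .a j ⟨j.val + k, h⟩ else .x j
  | .y j => if k ≤ j.val then .b ⟨j.val - k, by have := j.isLt; omega⟩ j else .y j
  | s => s

/-- The effect of raising on an entry of the lower row, lying below the entries `vl`, `vr`
of the upper row (where they exist). -/
def raiseLo (k : ℕ) (vl vr : Option (TSym n)) (s : TSym n) : TSym n :=
  match s with
  | .x j =>
      match vr with
      | some (.b j' l) => if j' = j then .b j' l else toV k (.x j)
      | _ => toV k (.x j)
  | .y l =>
      match vl with
      | some (.a j l') => if l' = l then .a j l' else toV k (.y l)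
      | _ => toV k (.y l)
  | s => s

/-- The effect of lowering on an entry `v` of the upper row, lying above the consecutive entries
`u`, `w` of the lower row. -/
def lowerUp (k : ℕ) (v u w : TSym n) : TSym n :=
  match v with
  | .x j =>
      match u with
      | .b j' l => if j' = j then .b j' l else toV k (.x j)
      | _ => toV k (.x j)
  | .y l =>
      match w with
      | .a j l' => if l' = l then .a j l' else toV k (.y l)
      | _ => toV k (.y l)
  | s => s

/-- The effect of lowering on an entry of the lower row, lying below the entries `vl`, `vr`
of the upper row (where they exist). -/
noncomputable def lowerLo (vl vr : Option (TSym n)) (s : TSym n) : TSym n :=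
  match s with
  | .b j l => if vr = some (.x j) then .x j else .y l
  | .a j l => if vl = some (.y l) then .y l else .x j
  | s => s

/-- The monotone diagonal property for `v`, in a row of rank `k'`, lying above the consecutive
entries `u`, `w` of a row of rank `k`. -/
def Diagonal (k k' : ℕ) (u v w : TSym n) : Prop :=
  u.lval k ≤ v.lval k' ∧ ((∃ j, u = .y j) → u.lval k < v.lval k') ∧
    v.rval k' ≤ w.rval k ∧ ((∃ j, w = .x j) → v.rval k' < w.rval k)

theorem lowerUp_raiseUp {k : ℕ} {u v w : TSym n} (vl vr : Option (TSym n)) (hv : v.isV k)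
    (hu : u.isX) (hw : w.isX) (h : Diagonal k k u v w) :
    lowerUp k (raiseUp v u w) (raiseLo k vl (some v) u) (raiseLo k (some v) vr w) = v := by
  unfold Diagonal at h
  cases v <;> simp only [isV] at hv <;> cases u <;> simp only [isX] at hu <;>
    cases w <;> simp only [isX] at hw <;>
    simp only [lval, rval, raiseUp, lowerUp, raiseLo, toV, y.injEq, x.injEq, reduceCtorEq, exists_eq',
      exists_false, forall_const, false_imp_iff] at * <;> grind

theorem raiseUp_lowerUp {k : ℕ} {u v w : TSym n} (vl vr : Option (TSym n)) (hv : v.isX)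
    (hu : u.isV k) (hw : w.isV k) (h : Diagonal k (k + 1) u v w)
    (hl : 1 ≤ v.lval (k + 1)) (hr : v.rval (k + 1) ≤ n) :
    raiseUp (lowerUp k v u w) (lowerLo vl (some v) u) (lowerLo (some v) vr w) = v := by
  unfold Diagonal at h
  cases v <;> simp only [isX] at hv <;> cases u <;> simp only [isV] at hu <;>
    cases w <;> simp only [isV] at hw <;>
    simp only [lval, rval, raiseUp, lowerUp, lowerLo, toV, reduceCtorEq, exists_false, false_imp_iff] at * <;> grind

theorem lowerLo_raiseLo {k : ℕ} {s : TSym n} {vl vr vl' vr' : Option (TSym n)} (hs : s.isX)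
    (h1 : 1 ≤ s.lval k) (h2 : s.rval k ≤ n)
    (hl : (vl = none ∧ vl' = none) ∨ ∃ u v, vl = some v ∧ vl' = some (raiseUp v u s) ∧
      v.isV k ∧ Diagonal k k u v s)
    (hr : (vr = none ∧ vr' = none) ∨ ∃ v w, vr = some v ∧ vr' = some (raiseUp v s w) ∧
      v.isV k ∧ Diagonal k k s v w) :
    lowerLo vl' vr' (raiseLo k vl vr s) = s := by
  unfold Diagonal at hl hr
  rcases hl with ⟨rfl, rfl⟩ | ⟨u, v, rfl, rfl, hv, hd⟩ <;>
    rcases hr with ⟨rfl, rfl⟩ | ⟨v', w, rfl, rfl, hv', hd'⟩ <;>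
    (try cases v <;> simp only [isV] at hv) <;> (try cases v' <;> simp only [isV] at hv') <;>
    cases s <;> simp only [isX] at hs <;>
    simp only [lval, rval, raiseUp, lowerLo, raiseLo, toV, y.injEq, x.injEq, reduceCtorEq, exists_eq',
      exists_false, forall_const, false_imp_iff] at * <;> grind

theorem raiseLo_lowerLo {k : ℕ} {s : TSym n} {vl vr vl' vr' : Option (TSym n)} (hs : s.isV k)
    (hl : (vl = none ∧ vl' = none) ∨ ∃ u v, vl = some v ∧ vl' = some (lowerUp k v u s) ∧
      v.isX ∧ Diagonal k (k + 1) u v s)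
    (hr : (vr = none ∧ vr' = none) ∨ ∃ v w, vr = some v ∧ vr' = some (lowerUp k v s w) ∧
      v.isX ∧ Diagonal k (k + 1) s v w) :
    raiseLo k vl' vr' (lowerLo vl vr s) = s := by
  unfold Diagonal at hl hr
  rcases hl with ⟨rfl, rfl⟩ | ⟨u, v, rfl, rfl, hv, hd⟩ <;>
    rcases hr with ⟨rfl, rfl⟩ | ⟨v', w, rfl, rfl, hv', hd'⟩ <;>
    (try cases v <;> simp only [isX] at hv) <;> (try cases v' <;> simp only [isX] at hv') <;>
    cases s <;> simp only [isV] at hs <;>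
    simp only [lval, rval, lowerUp, lowerLo, raiseLo, toV, reduceCtorEq, exists_false, false_imp_iff] at * <;> grind

end TSym

open TSym

/-- The entry diagonally above to the left, if it exists. -/
def aboveL (t : Tri n) (r : Fin n) (i : Fin (r.val + 1)) : Option (TSym n) :=
  if h : 1 ≤ i.val then
    some (t ⟨r.val - 1, by have := r.isLt; omega⟩ ⟨i.val - 1, by have := i.isLt; simp only; omega⟩)
  else none

/-- The entry diagonally above to the right, if it exists. -/
def aboveR (t : Tri n) (r : Fin n) (i : Fin (r.val + 1)) : Option (TSym n) :=
  if h : i.val < r.val then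
    some (t ⟨r.val - 1, by have := r.isLt; omega⟩ ⟨i.val, by simp only; omega⟩)
  else none

theorem raise_upper (t : Tri n) (r : ℕ) (h : r + 1 < n) (i : Fin (r + 1)) :
    Raise (r + 2) t ⟨r, by omega⟩ i =
      raiseUp (t ⟨r, by omega⟩ i) (t ⟨r + 1, h⟩ i.castSucc) (t ⟨r + 1, h⟩ i.succ) := by
  have hu : 2 ≤ r + 2 ∧ r + 2 = r + 2 ∧ r + 1 < n := ⟨by omega, rfl, h⟩
  rw [Raise, dif_pos hu]
  rfl

theorem lower_upper (t : Tri n) (r : ℕ) (h : r + 1 < n) (i : Fin (r + 1)) :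
    Lower (r + 2) t ⟨r, by omega⟩ i =
      lowerUp (rankOf t (r + 1)) (t ⟨r, by omega⟩ i) (t ⟨r + 1, h⟩ i.castSucc)
        (t ⟨r + 1, h⟩ i.succ) := by
  have hu : 2 ≤ r + 2 ∧ r + 2 = r + 2 ∧ r + 1 < n := ⟨by omega, rfl, h⟩
  rw [Lower, dif_pos hu]
  rfl

theorem raise_lower (t : Tri n) (r : Fin n) (i : Fin (r.val + 1)) :
    Raise (r.val + 1) t r i = raiseLo (rankOf t r) (aboveL t r i) (aboveR t r i) (t r i) := by
  have hu : ¬ (2 ≤ r.val + 1 ∧ r.val + 2 = r.val + 1 ∧ r.val + 1 < n) := by omega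
  simp only [Raise, dif_neg hu, dif_pos, aboveL, aboveR]
  cases t r i <;> simp only [raiseLo] <;> split <;> (try rfl) <;> grind [toV]

theorem lower_lower (t : Tri n) (r : Fin n) (i : Fin (r.val + 1)) :
    Lower (r.val + 1) t r i = lowerLo (aboveL t r i) (aboveR t r i) (t r i) := by
  have hu : ¬ (2 ≤ r.val + 1 ∧ r.val + 2 = r.val + 1 ∧ r.val + 1 < n) := by omega
  simp only [Lower, dif_neg hu, dif_pos, aboveL, aboveR]
  cases t r i <;> simp only [lowerLo] <;> split <;> simp

theorem raise_of_ne (t : Tri n) {d : ℕ} {r : Fin n} (h : r.val + 2 ≠ d) (h' : r.val + 1 ≠ d) :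
    Raise d t r = t r := by
  funext i
  simp [Raise, h, h']

theorem lower_of_ne (t : Tri n) {d : ℕ} {r : Fin n} (h : r.val + 2 ≠ d) (h' : r.val + 1 ≠ d) :
    Lower d t r = t r := by
  funext i
  simp [Lower, h, h']

theorem rankOf_congr {t t' : Tri n} {r : ℕ} (h : ∀ s : Fin n, r < s.val → t' s = t s) :
    rankOf t' r = rankOf t r := by
  unfold rankOf
  congr 2
  refine Finset.filter_congr fun s _ => and_congr_right fun hs => ?_
  simp only [IsVRow, IsVRowOf, h s hs]

theorem rankOf_raise (t : Tri n) (r : ℕ) : rankOf (Raise (r + 1) t) r = rankOf t r :=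
  rankOf_congr fun _ hs => raise_of_ne t (by omega) (by omega)

theorem rankOf_lower (t : Tri n) (r : ℕ) : rankOf (Lower (r + 1) t) r = rankOf t r :=
  rankOf_congr fun _ hs => lower_of_ne t (by omega) (by omega)

theorem not_isVRow_of_isXRow {t : Tri n} {r : Fin n} (h : IsXRow t r) : ¬ IsVRow t r := by
  rintro ⟨k, hk⟩
  have h1 := h 0
  have h2 := hk 0
  cases hs : t r 0 <;> simp [hs, isX, isV] at h1 h2

theorem rankOf_succ (t : Tri n) (r : ℕ) (h : r + 1 < n) :
    rankOf t r = rankOf t (r + 1) + if IsVRow t ⟨r + 1, h⟩ then 1 else 0 := by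
  unfold rankOf
  split_ifs with hv
  · rw [add_assoc, ← Finset.card_insert_of_notMem (a := (⟨r + 1, h⟩ : Fin n)) (by simp)]
    congr 2
    ext s
    simp only [mem_filter, mem_univ, true_and, mem_insert, Fin.ext_iff]
    constructor
    · rintro ⟨h1, h2⟩
      by_cases hs : s.val = r + 1
      · exact .inl hs
      · exact .inr ⟨by omega, h2⟩
    · rintro (h1 | ⟨h1, h2⟩)
      · obtain rfl : s = ⟨r + 1, h⟩ := Fin.ext h1
        exact ⟨by simp, hv⟩
      · exact ⟨by omega, h2⟩
  · rw [add_zero]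
    congr 2
    refine Finset.filter_congr fun s _ => ⟨?_, fun ⟨h1, h2⟩ => ⟨by omega, h2⟩⟩
    rintro ⟨h1, h2⟩
    refine ⟨lt_of_le_of_ne h1 fun hs => hv ?_, h2⟩
    obtain rfl : s = ⟨r + 1, h⟩ := Fin.ext hs.symm
    exact h2

theorem rankOf_eq_ranking {t : Tri n} {rk : ℕ → ℕ} (hb : BottomOK t) (hrk : IsRanking t rk)
    (m : ℕ) : ∀ r, r + 2 + m = n → rankOf t r = rk (r + 1) := by
  induction m with
  | zero =>
    intro r hr
    have hlast : ¬ IsVRow t ⟨r + 1, by omega⟩ := by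
      rintro ⟨k, hk⟩
      have := hk 0
      rw [hb ⟨r + 1, by omega⟩ (by simp only; omega) 0] at this
      exact this
    rw [rankOf_succ t r (by omega), if_neg hlast, show r + 1 = n - 1 by omega,
      hrk.2.1 (by omega), rankOf, Finset.card_eq_zero.2]
    refine Finset.filter_eq_empty_iff.2 fun s _ hs => ?_
    omega
  | succ m ih =>
    intro r hr
    rw [rankOf_succ t r (by omega), ih (r + 1) (by omega)]
    rcases hrk.2.2 ⟨r + 1, by omega⟩ (by simp only; omega) with ⟨h1, h2⟩ | ⟨h1, h2⟩
    · rw [if_neg (not_isVRow_of_isXRow h1)]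
      exact h2.symm
    · rw [if_pos ⟨_, h1⟩]
      exact h2.symm

theorem diagonal_of_monoProps {t : Tri n} {rk : ℕ → ℕ} (h : MonoProps t rk) (r : ℕ)
    (hr : r + 1 < n) (i : Fin (r + 1)) :
    Diagonal (rk (r + 2)) (rk (r + 1)) (t ⟨r + 1, hr⟩ i.castSucc) (t ⟨r, by omega⟩ i)
      (t ⟨r + 1, hr⟩ i.succ) := by
  obtain ⟨h1, h2, h3, h4, -⟩ :=
    h ⟨r + 1, hr⟩ (by simp) i.val (by have := i.isLt; simp only; omega)
  exact ⟨h1, h2, h3, h4⟩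

theorem one_le_lval_and_rval_le {t : Tri n} {rk : ℕ → ℕ} (hb : BottomOK t)
    (hm : MonoProps t rk) (m : ℕ) : ∀ (r : ℕ) (hr : r + 1 + m = n) (i : Fin (r + 1)),
    1 ≤ (t ⟨r, by omega⟩ i).lval (rk (r + 1)) ∧
      (t ⟨r, by omega⟩ i).rval (rk (r + 1)) ≤ n := by
  induction m with
  | zero =>
    intro r hr i
    rw [hb ⟨r, by omega⟩ (by simp only; omega) i]
    have := i.isLt
    simp only [lval, rval]
    omega
  | succ m ih =>
    intro r hr i
    obtain ⟨h1, -, h3, -⟩ := diagonal_of_monoProps hm r (by omega) i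
    exact ⟨(ih (r + 1) (by omega) i.castSucc).1.trans h1,
      h3.trans (ih (r + 1) (by omega) i.succ).2⟩

theorem above_zero (t : Tri n) (h : 0 < n) (i : Fin (0 + 1)) :
    aboveL t ⟨0, h⟩ i = none ∧ aboveR t ⟨0, h⟩ i = none := by
  have := i.isLt
  exact ⟨dif_neg (by omega), dif_neg (by simp)⟩

theorem aboveL_cases (r : ℕ) (h : r + 1 < n) (i : Fin (r + 1 + 1)) :
    (∀ t : Tri n, aboveL t ⟨r + 1, h⟩ i = none) ∨
      ∃ j : Fin (r + 1), i = j.succ ∧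
        ∀ t : Tri n, aboveL t ⟨r + 1, h⟩ i = some (t ⟨r, by omega⟩ j) := by
  induction i using Fin.cases with
  | zero => exact .inl fun t => dif_neg (by simp)
  | succ j => exact .inr ⟨j, rfl, fun t => dif_pos (by simp)⟩

theorem aboveR_cases (r : ℕ) (h : r + 1 < n) (i : Fin (r + 1 + 1)) :
    (∀ t : Tri n, aboveR t ⟨r + 1, h⟩ i = none) ∨
      ∃ j : Fin (r + 1), i = j.castSucc ∧
        ∀ t : Tri n, aboveR t ⟨r + 1, h⟩ i = some (t ⟨r, by omega⟩ j) := by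
  induction i using Fin.lastCases with
  | last => exact .inl fun t => dif_neg (by simp)
  | cast j => exact .inr ⟨j, rfl, fun t => dif_pos j.isLt⟩

theorem aboveR_castSucc (t : Tri n) (r : ℕ) (h : r + 1 < n) (j : Fin (r + 1)) :
    aboveR t ⟨r + 1, h⟩ j.castSucc = some (t ⟨r, by omega⟩ j) :=
  dif_pos j.isLt

theorem aboveL_succ (t : Tri n) (r : ℕ) (h : r + 1 < n) (j : Fin (r + 1)) :
    aboveL t ⟨r + 1, h⟩ j.succ = some (t ⟨r, by omega⟩ j) :=
  dif_pos (by simp)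

theorem lower_raise_eq_self {d : ℕ} {t : Tri n} (hdn : d + 1 < n) (hadm : IsAdmissible t)
    (hx : IsXRow t ⟨d, by omega⟩) (hv : ∀ (e : ℕ) (he : d = e + 1), IsVRow t ⟨e, by omega⟩) :
    Lower (d + 1) (Raise (d + 1) t) = t := by
  obtain ⟨hb, -, rk, hrk, hm⟩ := hadm
  have hrank : rankOf t d = rk (d + 1) := rankOf_eq_ranking hb hrk (n - (d + 2)) d (by omega)
  have hbound := one_le_lval_and_rval_le hb hm (n - (d + 1)) d (by omega)
  have hup : ∀ (e : ℕ) (he : d = e + 1), rk (e + 1) = rk (d + 1) ∧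
      ∀ i : Fin (e + 1), (t ⟨e, by omega⟩ i).isV (rk (d + 1)) := by
    rintro e rfl
    have hk : rk (e + 1) = rk (e + 1 + 1) := by
      rcases hrk.2.2 ⟨e + 1, by omega⟩ (by simp only; omega) with ⟨-, h⟩ | ⟨h, -⟩
      · exact h
      · exact absurd ⟨_, h⟩ (not_isVRow_of_isXRow hx)
    rcases hrk.2.2 ⟨e, by omega⟩ (by simp only; omega) with ⟨h, -⟩ | ⟨h, -⟩
    · exact absurd (hv e rfl) (not_isVRow_of_isXRow h)
    · exact ⟨hk, fun i => hk ▸ h i⟩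
  funext ⟨r, hr⟩ i
  by_cases hrd : r + 1 = d
  · subst hrd
    obtain ⟨hk, hV⟩ := hup r rfl
    have hd := diagonal_of_monoProps hm r (by omega) i
    rw [hk] at hd
    rw [lower_upper _ _ (by omega), rankOf_raise, raise_upper _ _ (by omega),
      raise_lower t ⟨r + 1, by omega⟩ i.castSucc, raise_lower t ⟨r + 1, by omega⟩ i.succ,
      aboveR_castSucc, aboveL_succ, hrank]
    exact lowerUp_raiseUp _ _ (hV i) (hx _) (hx _) hd
  by_cases hrd' : r = d
  · subst hrd'
    rw [lower_lower _ ⟨r, hr⟩ i, raise_lower t ⟨r, hr⟩ i]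
    simp only [hrank]
    refine lowerLo_raiseLo (hx i) (hbound i).1 (hbound i).2 ?_ ?_
    · cases r with
      | zero => exact .inl ⟨(above_zero _ _ _).1, (above_zero _ _ _).1⟩
      | succ e =>
        obtain ⟨hk, hV⟩ := hup e rfl
        rcases aboveL_cases e hr i with h | ⟨j, rfl, h⟩
        · exact .inl ⟨h _, h _⟩
        · have hd := diagonal_of_monoProps hm e hr j
          rw [hk] at hd
          exact .inr ⟨_, _, h _, (h _).trans (congrArg some (raise_upper t e hr j)), hV j, hd⟩
    · cases r with
      | zero => exact .inl ⟨(above_zero _ _ _).2, (above_zero _ _ _).2⟩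
      | succ e =>
        obtain ⟨hk, hV⟩ := hup e rfl
        rcases aboveR_cases e hr i with h | ⟨j, rfl, h⟩
        · exact .inl ⟨h _, h _⟩
        · have hd := diagonal_of_monoProps hm e hr j
          rw [hk] at hd
          exact .inr ⟨_, _, h _, (h _).trans (congrArg some (raise_upper t e hr j)), hV j, hd⟩
  rw [lower_of_ne _ (by simp only; omega) (by simp only; omega),
    raise_of_ne _ (by simp only; omega) (by simp only; omega)]

theorem raise_lower_eq_self {d : ℕ} {t : Tri n} (hdn : d + 1 < n) (hadm : IsAdmissible t)
    (hv : IsVRow t ⟨d, by omega⟩) (hx : ∀ (e : ℕ) (he : d = e + 1), IsXRow t ⟨e, by omega⟩) :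
    Raise (d + 1) (Lower (d + 1) t) = t := by
  obtain ⟨hb, -, rk, hrk, hm⟩ := hadm
  have hrank : rankOf t d = rk (d + 1) := rankOf_eq_ranking hb hrk (n - (d + 2)) d (by omega)
  obtain ⟨hV, hk⟩ : IsVRowOf t ⟨d, by omega⟩ (rk (d + 1)) ∧ rk d = rk (d + 1) + 1 := by
    rcases hrk.2.2 ⟨d, by omega⟩ (by simp only; omega) with ⟨h, -⟩ | h
    · exact absurd hv (not_isVRow_of_isXRow h)
    · exact h
  funext ⟨r, hr⟩ i
  by_cases hrd : r + 1 = d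
  · subst hrd
    have hd := diagonal_of_monoProps hm r (by omega) i
    have hbound := one_le_lval_and_rval_le hb hm (n - (r + 1)) r (by omega) i
    rw [hk] at hd hbound
    rw [raise_upper _ _ (by omega), lower_upper _ _ (by omega),
      lower_lower t ⟨r + 1, by omega⟩ i.castSucc, lower_lower t ⟨r + 1, by omega⟩ i.succ,
      aboveR_castSucc, aboveL_succ, hrank]
    exact raiseUp_lowerUp _ _ (hx r rfl i) (hV _) (hV _) hd hbound.1 hbound.2
  by_cases hrd' : r = d
  · subst hrd'
    rw [raise_lower _ ⟨r, hr⟩ i, lower_lower t ⟨r, hr⟩ i, rankOf_lower]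
    simp only [hrank]
    refine raiseLo_lowerLo (hV i) ?_ ?_
    · cases r with
      | zero => exact .inl ⟨(above_zero _ _ _).1, (above_zero _ _ _).1⟩
      | succ e =>
        rcases aboveL_cases e hr i with h | ⟨j, rfl, h⟩
        · exact .inl ⟨h _, h _⟩
        · have hd := diagonal_of_monoProps hm e hr j
          rw [hk] at hd
          exact .inr ⟨_, _, h _,
            (h _).trans (congrArg some ((lower_upper t e hr j).trans (by rw [hrank]))),
            hx e rfl j, hd⟩
    · cases r with
      | zero => exact .inl ⟨(above_zero _ _ _).2, (above_zero _ _ _).2⟩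
      | succ e =>
        rcases aboveR_cases e hr i with h | ⟨j, rfl, h⟩
        · exact .inl ⟨h _, h _⟩
        · have hd := diagonal_of_monoProps hm e hr j
          rw [hk] at hd
          exact .inr ⟨_, _, h _,
            (h _).trans (congrArg some ((lower_upper t e hr j).trans (by rw [hrank]))),
            hx e rfl j, hd⟩
  rw [raise_of_ne _ (by simp only; omega) (by simp only; omega),
    lower_of_ne _ (by simp only; omega) (by simp only; omega)]

/-- Raising and lowering are mutually inverse on admissible triangles. -/
theorem stmt15 (n d : ℕ) (t : Tri n) (h1 : 1 ≤ d) (h2 : d < n) (hadm : IsAdmissible t) :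
    (IsXRow t ⟨d - 1, by omega⟩ → (∀ _ : 2 ≤ d, IsVRow t ⟨d - 2, by omega⟩) →
        Lower d (Raise d t) = t) ∧
    (IsVRow t ⟨d - 1, by omega⟩ → (∀ _ : 2 ≤ d, IsXRow t ⟨d - 2, by omega⟩) →
        Raise d (Lower d t) = t) := by
  obtain ⟨d, rfl⟩ : ∃ e, d = e + 1 := ⟨d - 1, by omega⟩
  constructor
  · intro hx hv
    refine lower_raise_eq_self h2 hadm hx fun e he => ?_
    subst he
    exact hv (by omega)
  · intro hv hx
    refine raise_lower_eq_self h2 hadm hv fun e he => ?_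
    subst he
    exact hx (by omega)
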